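/- arXiv:2605.20213 — 6 statements merged into one kernel-verified Lean document; each statement's English description precedes it below -/
import Mathlib

section
/- Fix d ≥ 1, ν > 0, and c : ℤ^d → ℝ bounded and even (c(−ξ) = c(ξ)). Let ξ₀ ∈ ℤ^d with ξ₀ ≠ 0 and c(ξ₀) < 0, set γ_c = ν²k_{ξ₀}/|c(ξ₀)| and C_* = √(k_{ξ₀}·|c(ξ₀)|), and assume the critical pair is unique: for every ξ ∉ {ξ₀, −ξ₀} with ξ ≠ 0 and c(ξ) < 0 one has ν²k_ξ/|c(ξ)| > γ_c. Then there exists δ > 0 such that for every γ with γ_c − δ < γ < γ_c, the spectral gap ρ(γ) = inf over ξ ≠ 0 of √(σ_ξ(γ)) satisfies the exact identity ρ(γ) = C_*·√(γ_c − γ). -/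
open Real

/-- `k_ξ = 4π²|ξ|²` for `ξ ∈ ℤ^d`. -/
noncomputable def modeK {d : ℕ} (ξ : Fin d → ℤ) : ℝ :=
  4 * π ^ 2 * ∑ i, ((ξ i : ℝ)) ^ 2

/-- The dispersion `σ_ξ(γ) = ν²k_ξ² + γ k_ξ c(ξ)`. -/
noncomputable def dispersion {d : ℕ} (ν : ℝ) (c : (Fin d → ℤ) → ℝ) (γ : ℝ)
    (ξ : Fin d → ℤ) : ℝ :=
  ν ^ 2 * (modeK ξ) ^ 2 + γ * modeK ξ * c ξ

/-- The spectral gap `ρ(γ) = inf_{ξ ≠ 0} √(σ_ξ(γ))`. -/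
noncomputable def spectralGap {d : ℕ} (ν : ℝ) (c : (Fin d → ℤ) → ℝ) (γ : ℝ) : ℝ :=
  sInf {x : ℝ | ∃ ξ : Fin d → ℤ, ξ ≠ 0 ∧ x = Real.sqrt (dispersion ν c γ ξ)}

lemma continuous_dispersion {d : ℕ} (ν : ℝ) (c : (Fin d → ℤ) → ℝ) (ξ : Fin d → ℤ) :
    Continuous fun γ => dispersion ν c γ ξ := by
  unfold dispersion
  fun_prop

lemma modeK_neg {d : ℕ} (ξ : Fin d → ℤ) : modeK (-ξ) = modeK ξ := by
  simp [modeK]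

lemma sq_le_modeK {d : ℕ} (ξ : Fin d → ℤ) (i : Fin d) : ((ξ i : ℝ)) ^ 2 ≤ modeK ξ := by
  have hsum : ((ξ i : ℝ)) ^ 2 ≤ ∑ j, ((ξ j : ℝ)) ^ 2 :=
    Finset.single_le_sum (f := fun j => ((ξ j : ℝ)) ^ 2)
      (fun j _ => sq_nonneg _) (Finset.mem_univ i)
  have hpi : 1 ≤ 4 * π ^ 2 := by nlinarith [Real.pi_gt_three]
  unfold modeK
  nlinarith [sq_nonneg (ξ i : ℝ)]

lemma one_le_modeK {d : ℕ} {ξ : Fin d → ℤ} (hξ : ξ ≠ 0) : 1 ≤ modeK ξ := by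
  obtain ⟨i, hi⟩ := Function.ne_iff.mp hξ
  have hsq : (1 : ℤ) ≤ ξ i ^ 2 := Int.add_one_le_iff.mpr (sq_pos_of_ne_zero hi)
  have hsq' : (1 : ℝ) ≤ (ξ i : ℝ) ^ 2 := by exact_mod_cast hsq
  exact hsq'.trans (sq_le_modeK ξ i)

lemma finite_setOf_modeK_le {d : ℕ} (M : ℝ) : {ξ : Fin d → ℤ | modeK ξ ≤ M}.Finite := by
  refine (Set.finite_Icc (fun _ : Fin d => -⌈M⌉) (fun _ => ⌈M⌉)).subset fun ξ hξ => ?_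
  have hcoord (i : Fin d) : |ξ i| ≤ ⌈M⌉ := by
    have hsq : ξ i ^ 2 ≤ ⌈M⌉ := by
      exact_mod_cast ((sq_le_modeK ξ i).trans hξ).trans (Int.le_ceil M)
    rw [Int.abs_eq_natAbs]
    exact (Int.natAbs_le_self_sq (ξ i)).trans hsq
  exact ⟨fun i => (abs_le.mp (hcoord i)).1, fun i => (abs_le.mp (hcoord i)).2⟩

theorem spectral_gap_sqrt_scaling {d : ℕ} (hd : 1 ≤ d) (ν : ℝ) (hν : 0 < ν)
    (c : (Fin d → ℤ) → ℝ) (B : ℝ) (hB : ∀ ξ : Fin d → ℤ, |c ξ| ≤ B)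
    (heven : ∀ ξ : Fin d → ℤ, c (-ξ) = c ξ)
    (ξ₀ : Fin d → ℤ) (hξ₀ : ξ₀ ≠ 0) (hcξ₀ : c ξ₀ < 0)
    (γc Cstar : ℝ)
    (hγc : γc = ν ^ 2 * modeK ξ₀ / |c ξ₀|)
    (hCstar : Cstar = Real.sqrt (modeK ξ₀ * |c ξ₀|))
    (huniq : ∀ ξ : Fin d → ℤ, ξ ≠ ξ₀ → ξ ≠ -ξ₀ → ξ ≠ 0 → c ξ < 0 →
      γc < ν ^ 2 * modeK ξ / |c ξ|) :
    ∃ δ : ℝ, 0 < δ ∧ ∀ γ : ℝ, γc - δ < γ → γ < γc →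
      spectralGap ν c γ = Cstar * Real.sqrt (γc - γ) := by
  have hk₀ : 0 < modeK ξ₀ := zero_lt_one.trans_le (one_le_modeK hξ₀)
  have hc₀ : 0 < |c ξ₀| := abs_pos.mpr hcξ₀.ne
  have hγc_pos : 0 < γc := by rw [hγc]; positivity
  have hB₀ : 0 ≤ B := hc₀.le.trans (hB ξ₀)
  have hcrit : γc * |c ξ₀| = ν ^ 2 * modeK ξ₀ := by
    rw [hγc, div_mul_cancel₀ _ hc₀.ne']
  have hdisp₀ (γ : ℝ) : dispersion ν c γ ξ₀ = modeK ξ₀ * |c ξ₀| * (γc - γ) := by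
    rw [abs_of_neg hcξ₀] at hcrit ⊢
    unfold dispersion
    linear_combination -modeK ξ₀ * hcrit
  have hdisp_neg (γ : ℝ) : dispersion ν c γ (-ξ₀) = dispersion ν c γ ξ₀ := by
    simp only [dispersion, modeK_neg, heven]
  have hpos (ξ : Fin d → ℤ) (h0 : ξ ≠ 0) (h1 : ξ ≠ ξ₀) (h2 : ξ ≠ -ξ₀) :
      0 < dispersion ν c γc ξ := by
    have hk : 0 < modeK ξ := zero_lt_one.trans_le (one_le_modeK h0)
    rcases lt_or_ge (c ξ) 0 with hc | hc
    · have hlt := huniq ξ h1 h2 h0 hc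
      rw [lt_div_iff₀ (abs_pos.mpr hc.ne), abs_of_neg hc] at hlt
      unfold dispersion
      nlinarith [mul_pos hk (sub_pos.mpr hlt)]
    · unfold dispersion
      positivity
  have hlow : ∀ᶠ γ in nhds γc, ∀ ξ ∈ {ξ : Fin d → ℤ | modeK ξ ≤ (γc * B + 1) / ν ^ 2},
      ξ ≠ 0 → ξ ≠ ξ₀ → ξ ≠ -ξ₀ → dispersion ν c γ ξ₀ < dispersion ν c γ ξ := by
    rw [Filter.eventually_all_finite (finite_setOf_modeK_le _)]
    intro ξ _
    by_cases h : ξ ≠ 0 ∧ ξ ≠ ξ₀ ∧ ξ ≠ -ξ₀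
    · obtain ⟨h0, h1, h2⟩ := h
      have hlt : dispersion ν c γc ξ₀ < dispersion ν c γc ξ := by
        rw [hdisp₀, sub_self, mul_zero]
        exact hpos ξ h0 h1 h2
      filter_upwards [(continuous_dispersion ν c ξ₀).continuousAt.eventually_lt
        (continuous_dispersion ν c ξ).continuousAt hlt] with γ hγ _ _ _ using hγ
    · exact .of_forall fun γ h0 h1 h2 => absurd ⟨h0, h1, h2⟩ h
  have hsmall : ∀ᶠ γ in nhds γc, dispersion ν c γ ξ₀ < 1 := by
    refine (continuous_dispersion ν c ξ₀).continuousAt.eventually_lt continuousAt_const ?_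
    simp [hdisp₀]
  obtain ⟨δ, hδ, hnear⟩ := Metric.eventually_nhds_iff.mp
    (hlow.and (hsmall.and (eventually_gt_nhds hγc_pos)))
  refine ⟨δ, hδ, fun γ hγ₁ hγ₂ => ?_⟩
  obtain ⟨hlowγ, hsmallγ, hγ_pos⟩ := hnear (y := γ) (by
    rw [Real.dist_eq, abs_lt]
    constructor <;> linarith)
  have hmin (ξ : Fin d → ℤ) (h0 : ξ ≠ 0) : dispersion ν c γ ξ₀ ≤ dispersion ν c γ ξ := by
    by_cases h1 : ξ = ξ₀
    · rw [h1]
    by_cases h2 : ξ = -ξ₀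
    · rw [h2, hdisp_neg]
    rcases le_or_gt (modeK ξ) ((γc * B + 1) / ν ^ 2) with hle | hgt
    · exact (hlowγ ξ hle h0 h1 h2).le
    · rw [div_lt_iff₀ (by positivity)] at hgt
      have hk := one_le_modeK h0
      have hγc_le : -(γc * B) ≤ γ * c ξ := by
        have := mul_le_mul_of_nonneg_left (neg_le_of_abs_le (hB ξ)) hγ_pos.le
        nlinarith [mul_le_mul_of_nonneg_right hγ₂.le hB₀]
      have hfactor : dispersion ν c γ ξ = modeK ξ * (modeK ξ * ν ^ 2 + γ * c ξ) := by
        unfold dispersion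
        ring
      have hone : 1 ≤ modeK ξ * ν ^ 2 + γ * c ξ := by linarith
      rw [hfactor]
      exact hsmallγ.le.trans (one_le_mul_of_one_le_of_one_le hk hone)
  have hleast : IsLeast
      {x : ℝ | ∃ ξ : Fin d → ℤ, ξ ≠ 0 ∧ x = Real.sqrt (dispersion ν c γ ξ)}
      (Real.sqrt (dispersion ν c γ ξ₀)) := by
    refine ⟨⟨ξ₀, hξ₀, rfl⟩, ?_⟩
    rintro _ ⟨ξ, h0, rfl⟩
    exact Real.sqrt_le_sqrt (hmin ξ h0)
  rw [spectralGap, hleast.csInf_eq, hdisp₀, hCstar, Real.sqrt_mul (by positivity)]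
end

section
/- Fix real numbers ν > 0, γ ≥ 0, k > 0, and c, and assume σ = ν²k² + γkc > 0. For every T > 0 and every pair of real boundary data (v₀, g), there exists exactly one pair of differentiable functions u, v : ℝ → ℝ satisfying, for all t ∈ [0, T], the linear system u'(t) = νk·u(t) − γc·v(t) and v'(t) = −k·u(t) − νk·v(t), together with the mixed boundary conditions v(0) = v₀ and u(T) = g. -/
/-- For `s ^ 2 = a ^ 2 + b * k`, the explicit flow of the linear system with matrix
`!![a, -b; -k, -a]` started at `(p, q)`. -/
theorem hasDerivAt_hyperbolic_flow {a b k s : ℝ} (hs : s ≠ 0) (h : s ^ 2 = a ^ 2 + b * k)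
    (p q t : ℝ) :
    HasDerivAt (fun t => Real.cosh (s * t) * p + Real.sinh (s * t) / s * (a * p - b * q))
      (a * (Real.cosh (s * t) * p + Real.sinh (s * t) / s * (a * p - b * q)) -
        b * (Real.cosh (s * t) * q + Real.sinh (s * t) / s * (-(k * p) - a * q))) t ∧
    HasDerivAt (fun t => Real.cosh (s * t) * q + Real.sinh (s * t) / s * (-(k * p) - a * q))
      (-(k * (Real.cosh (s * t) * p + Real.sinh (s * t) / s * (a * p - b * q))) -
        a * (Real.cosh (s * t) * q + Real.sinh (s * t) / s * (-(k * p) - a * q))) t := by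
  have hl : HasDerivAt (fun t => s * t) s t := by simpa using (hasDerivAt_id t).const_mul s
  have hc := hl.cosh
  have hd := hl.sinh.div_const s
  constructor
  · refine HasDerivAt.congr_deriv ((hc.mul_const p).add (hd.mul_const (a * p - b * q))) ?_
    field_simp
    linear_combination Real.sinh (s * t) * p * h
  · refine HasDerivAt.congr_deriv ((hc.mul_const q).add (hd.mul_const (-(k * p) - a * q))) ?_
    field_simp
    linear_combination Real.sinh (s * t) * q * h

/-- A solution on `[0, T]` of the linear system with matrix `!![a, -b; -k, -a]` is the explicit
flow of its initial values. -/
theorem eq_hyperbolic_flow {a b k s T : ℝ} (hs : s ≠ 0) (h : s ^ 2 = a ^ 2 + b * k)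
    {u v : ℝ → ℝ} (hu : ∀ t ∈ Set.Icc 0 T, HasDerivAt u (a * u t - b * v t) t)
    (hv : ∀ t ∈ Set.Icc 0 T, HasDerivAt v (-(k * u t) - a * v t) t)
    {t : ℝ} (ht : t ∈ Set.Icc 0 T) :
    u t = Real.cosh (s * t) * u 0 + Real.sinh (s * t) / s * (a * u 0 - b * v 0) ∧
    v t = Real.cosh (s * t) * v 0 + Real.sinh (s * t) / s * (-(k * u 0) - a * v 0) := by
  have hl (t : ℝ) : HasDerivAt (fun t => s * t) s t := by
    simpa using (hasDerivAt_id t).const_mul s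
  have hP : ∀ x ∈ Set.Icc 0 T, HasDerivAt
      (fun t => Real.cosh (s * t) * u t - Real.sinh (s * t) / s * (a * u t - b * v t)) 0 x := by
    intro x hx
    refine HasDerivAt.congr_deriv (((hl x).cosh.mul (hu x hx)).sub (((hl x).sinh.div_const s).mul
      (((hu x hx).const_mul a).sub ((hv x hx).const_mul b)))) ?_
    field_simp
    linear_combination Real.sinh (s * x) * u x * h
  have hQ : ∀ x ∈ Set.Icc 0 T, HasDerivAt
      (fun t => Real.cosh (s * t) * v t - Real.sinh (s * t) / s * (-(k * u t) - a * v t)) 0 x := by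
    intro x hx
    refine HasDerivAt.congr_deriv (((hl x).cosh.mul (hv x hx)).sub (((hl x).sinh.div_const s).mul
      (((hu x hx).const_mul k).neg.sub ((hv x hx).const_mul a)))) ?_
    field_simp
    linear_combination Real.sinh (s * x) * v x * h
  have hP0 := constant_of_has_deriv_right_zero
    (fun x hx => (hP x hx).continuousAt.continuousWithinAt)
    (fun x hx => (hP x (Set.Ico_subset_Icc_self hx)).hasDerivWithinAt) t ht
  have hQ0 := constant_of_has_deriv_right_zero
    (fun x hx => (hQ x hx).continuousAt.continuousWithinAt)
    (fun x hx => (hQ x (Set.Ico_subset_Icc_self hx)).hasDerivWithinAt) t ht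
  simp only [mul_zero, Real.cosh_zero, Real.sinh_zero, zero_div, zero_mul, sub_zero, one_mul]
    at hP0 hQ0
  have hcs := Real.cosh_sq (s * t)
  rw [← hP0, ← hQ0]
  constructor
  · field_simp
    linear_combination (-s ^ 2 * u t) * hcs - (Real.sinh (s * t)) ^ 2 * u t * h
  · field_simp
    linear_combination (-s ^ 2 * v t) * hcs - (Real.sinh (s * t)) ^ 2 * v t * h

theorem mode_bvp_exists_unique (ν γ k c : ℝ) (hν : 0 < ν) (hγ : 0 ≤ γ) (hk : 0 < k)
    (σ : ℝ) (hσ : σ = ν ^ 2 * k ^ 2 + γ * k * c) (hσpos : 0 < σ)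
    (T : ℝ) (hT : 0 < T) (v₀ g : ℝ) :
    ∃ u v : ℝ → ℝ,
      (Differentiable ℝ u ∧ Differentiable ℝ v ∧
        (∀ t ∈ Set.Icc (0 : ℝ) T,
          HasDerivAt u (ν * k * u t - γ * c * v t) t ∧
          HasDerivAt v (-(k * u t) - ν * k * v t) t) ∧
        v 0 = v₀ ∧ u T = g) ∧
      (∀ u' v' : ℝ → ℝ,
        (Differentiable ℝ u' ∧ Differentiable ℝ v' ∧
          (∀ t ∈ Set.Icc (0 : ℝ) T,
            HasDerivAt u' (ν * k * u' t - γ * c * v' t) t ∧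
            HasDerivAt v' (-(k * u' t) - ν * k * v' t) t) ∧
          v' 0 = v₀ ∧ u' T = g) →
        ∀ t ∈ Set.Icc (0 : ℝ) T, u' t = u t ∧ v' t = v t) := by
  have hs : 0 < √σ := Real.sqrt_pos.2 hσpos
  have h : √σ ^ 2 = (ν * k) ^ 2 + γ * c * k := by rw [Real.sq_sqrt hσpos.le, hσ]; ring
  set s := √σ
  have hS : 0 < Real.sinh (s * T) := Real.sinh_pos_iff.2 (by positivity)
  have hC := Real.cosh_pos (s * T)
  have hD : 0 < Real.cosh (s * T) + Real.sinh (s * T) / s * (ν * k) := by positivity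
  set D := Real.cosh (s * T) + Real.sinh (s * T) / s * (ν * k) with hDdef
  set p := (g + Real.sinh (s * T) / s * (γ * c * v₀)) / D with hp
  have hpD : p * D = g + Real.sinh (s * T) / s * (γ * c * v₀) := div_mul_cancel₀ _ hD.ne'
  have hflow := hasDerivAt_hyperbolic_flow hs.ne' h p v₀
  refine ⟨_, _, ⟨fun t => (hflow t).1.differentiableAt, fun t => (hflow t).2.differentiableAt,
    fun t _ => hflow t, by simp, by linear_combination hpD⟩, ?_⟩
  rintro u v ⟨-, -, hode, hv0, huT⟩ t ht
  have hrep {x : ℝ} (hx : x ∈ Set.Icc 0 T) := eq_hyperbolic_flow hs.ne' h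
    (fun t ht => (hode t ht).1) (fun t ht => (hode t ht).2) hx
  have hu0 : u 0 = p := by
    have hT' := (hrep (Set.right_mem_Icc.2 hT.le)).1
    rw [huT, hv0] at hT'
    rw [hp, eq_div_iff hD.ne', hDdef]
    linear_combination -hT'
  simpa only [hu0, hv0] using hrep ht
end

section
/- Fix real numbers ν > 0, γ ≥ 0, k > 0, and c, assume σ = ν²k² + γkc > 0, and set ρ = √σ. There exists a constant C > 0, depending only on ν, γ, k, c (and in particular independent of T), such that for every T > 0, every v₀, g ∈ ℝ, and every pair of differentiable functions u, v : ℝ → ℝ satisfying u'(t) = νk·u(t) − γc·v(t) and v'(t) = −k·u(t) − νk·v(t) for all t ∈ [0,T] with v(0) = v₀ and u(T) = g, one has for all t ∈ [0, T]: |u(t)| + |v(t)| ≤ C·(e^{−ρt} + e^{−ρ(T−t)})·(|v₀| + |g|). -/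
/-- A solution of `w' = r w` on `[0, T]` is an exponential there. -/
theorem eq_exp_mul_of_hasDerivAt_Icc {r T : ℝ} {w : ℝ → ℝ}
    (hw : ∀ t ∈ Set.Icc (0 : ℝ) T, HasDerivAt w (r * w t) t) {t : ℝ}
    (ht : t ∈ Set.Icc (0 : ℝ) T) : w t = Real.exp (r * t) * w 0 := by
  have hder : ∀ s ∈ Set.Icc (0 : ℝ) T,
      HasDerivAt (fun s => Real.exp (-(r * s)) * w s) 0 s := by
    intro s hs
    have h := (((hasDerivAt_id s).const_mul r).neg.exp).mul (hw s hs)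
    refine h.congr_deriv ?_
    simp only [id, Pi.neg_apply]
    ring
  have hconst := constant_of_has_deriv_right_zero
    (fun s hs => (hder s hs).continuousAt.continuousWithinAt)
    (fun s hs => (hder s (Set.Ico_subset_Icc_self hs)).hasDerivWithinAt) t ht
  simp only [mul_zero, neg_zero, Real.exp_zero, one_mul] at hconst
  rw [← hconst, ← mul_assoc, ← Real.exp_add, add_neg_cancel, Real.exp_zero, one_mul]

/-- Bounds on the amplitudes `P`, `Q` of the growing and decaying modes in terms of the boundary
data, uniform in the transmission factor `E ∈ [0, 1]`. -/
theorem abs_amplitude_le {a k ρ E P Q x y : ℝ} (ha : 0 < a) (hk : 0 < k) (hρ : 0 < ρ)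
    (hE0 : 0 ≤ E) (hE1 : E ≤ 1) (hx : Q - E * P = 2 * ρ * x)
    (hy : (a + ρ) * P - (a - ρ) * (E * Q) = 2 * ρ * k * y) :
    |P| ≤ 2 * (k + a + 2 * ρ) * (|x| + |y|) ∧ |Q| ≤ 2 * (k + a + 2 * ρ) * (|x| + |y|) := by
  have hPeq : P * ((a + ρ) - (a - ρ) * E ^ 2) = 2 * ρ * (k * y + (a - ρ) * E * x) := by
    linear_combination hy + (a - ρ) * E * hx
  have hE2 : E ^ 2 ≤ 1 := pow_le_one₀ hE0 hE1
  have hD : ρ ≤ (a + ρ) - (a - ρ) * E ^ 2 := by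
    nlinarith [mul_nonneg ha.le (sub_nonneg.2 hE2), mul_nonneg hρ.le (sq_nonneg E)]
  have hnum : |k * y + (a - ρ) * E * x| ≤ k * |y| + (a + ρ) * |x| := by
    have haρ : |a - ρ| ≤ a + ρ := abs_le.2 ⟨by linarith, by linarith⟩
    have hcoef : |a - ρ| * E ≤ a + ρ := by nlinarith [abs_nonneg (a - ρ)]
    calc |k * y + (a - ρ) * E * x| ≤ |k * y| + |(a - ρ) * E * x| := abs_add_le _ _
      _ = k * |y| + |a - ρ| * E * |x| := by
        rw [abs_mul, abs_mul, abs_mul, abs_of_pos hk, abs_of_nonneg hE0]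
      _ ≤ k * |y| + (a + ρ) * |x| := by gcongr
  have hP : |P| ≤ 2 * (k * |y| + (a + ρ) * |x|) := by
    have h := congrArg abs hPeq
    rw [abs_mul, abs_mul, abs_of_pos (hρ.trans_le hD), abs_of_pos (by positivity : 0 < 2 * ρ)] at h
    refine le_of_mul_le_mul_left ?_ hρ
    nlinarith [mul_le_mul_of_nonneg_left hD (abs_nonneg P),
      mul_le_mul_of_nonneg_left hnum hρ.le]
  have hQ : |Q| ≤ 2 * ρ * |x| + |P| := by
    calc |Q| = |2 * ρ * x + E * P| := by rw [← hx]; ring_nf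
      _ ≤ |2 * ρ * x| + |E * P| := abs_add_le _ _
      _ = 2 * ρ * |x| + E * |P| := by
        rw [abs_mul, abs_mul E, abs_of_pos (by positivity : 0 < 2 * ρ), abs_of_nonneg hE0]
      _ ≤ 2 * ρ * |x| + |P| := by nlinarith [abs_nonneg P]
  have hxk := mul_nonneg hk.le (abs_nonneg x)
  have hxρ := mul_nonneg hρ.le (abs_nonneg x)
  have hya := mul_nonneg ha.le (abs_nonneg y)
  have hyρ := mul_nonneg hρ.le (abs_nonneg y)
  constructor <;> nlinarith

theorem mode_boundary_layer_estimate (ν γ k c : ℝ) (hν : 0 < ν) (hγ : 0 ≤ γ) (hk : 0 < k)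
    (σ : ℝ) (hσ : σ = ν ^ 2 * k ^ 2 + γ * k * c) (hσpos : 0 < σ)
    (ρ : ℝ) (hρ : ρ = Real.sqrt σ) :
    ∃ C : ℝ, 0 < C ∧
      ∀ T : ℝ, 0 < T → ∀ v₀ g : ℝ, ∀ u v : ℝ → ℝ,
        Differentiable ℝ u → Differentiable ℝ v →
        (∀ t ∈ Set.Icc (0 : ℝ) T,
          HasDerivAt u (ν * k * u t - γ * c * v t) t ∧
          HasDerivAt v (-(k * u t) - ν * k * v t) t) →
        v 0 = v₀ → u T = g →
        ∀ t ∈ Set.Icc (0 : ℝ) T,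
          |u t| + |v t| ≤
            C * (Real.exp (-(ρ * t)) + Real.exp (-(ρ * (T - t)))) * (|v₀| + |g|) := by
  have hρ0 : 0 < ρ := hρ ▸ Real.sqrt_pos.2 hσpos
  have hρ2 : ρ ^ 2 = ν ^ 2 * k ^ 2 + γ * k * c := by rw [hρ, Real.sq_sqrt hσpos.le, hσ]
  have ha0 : 0 < ν * k := mul_pos hν hk
  set a := ν * k with ha
  refine ⟨(k + a + ρ) / (2 * ρ * k) * (2 * (k + a + 2 * ρ)), by positivity, ?_⟩
  rintro T hT v₀ g u v - - hode rfl rfl t ht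
  have hp : ∀ s ∈ Set.Icc (0 : ℝ) T, HasDerivAt (fun s => k * u s + (a - ρ) * v s)
      (ρ * (k * u s + (a - ρ) * v s)) s := fun s hs =>
    (((hode s hs).1.const_mul k).add ((hode s hs).2.const_mul (a - ρ))).congr_deriv <| by
      rw [ha]
      linear_combination v s * hρ2
  have hq : ∀ s ∈ Set.Icc (0 : ℝ) T, HasDerivAt (fun s => k * u s + (a + ρ) * v s)
      (-ρ * (k * u s + (a + ρ) * v s)) s := fun s hs =>
    (((hode s hs).1.const_mul k).add ((hode s hs).2.const_mul (a + ρ))).congr_deriv <| by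
      rw [ha]
      linear_combination v s * hρ2
  have hT' : T ∈ Set.Icc (0 : ℝ) T := ⟨hT.le, le_rfl⟩
  have hpT := eq_exp_mul_of_hasDerivAt_Icc hp hT'
  have hpt := eq_exp_mul_of_hasDerivAt_Icc hp ht
  have hqT := eq_exp_mul_of_hasDerivAt_Icc hq hT'
  have hqt := eq_exp_mul_of_hasDerivAt_Icc hq ht
  set P := k * u T + (a - ρ) * v T
  set Q := k * u 0 + (a + ρ) * v 0
  have hp0 : k * u 0 + (a - ρ) * v 0 = Real.exp (-ρ * T) * P := by
    rw [hpT, ← mul_assoc, ← Real.exp_add, neg_mul, neg_add_cancel, Real.exp_zero, one_mul]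
  rw [hp0, ← mul_assoc, ← Real.exp_add,
    show ρ * t + -ρ * T = -(ρ * (T - t)) by ring] at hpt
  rw [show -ρ * t = -(ρ * t) by ring] at hqt
  obtain ⟨hPle, hQle⟩ := abs_amplitude_le (x := v 0) (y := u T) ha0 hk hρ0
    (Real.exp_pos (-ρ * T)).le (Real.exp_le_one_iff.2 (by nlinarith))
    (P := P) (Q := Q) (by rw [← hp0]; ring) (by rw [← hqT]; ring)
  set p := Real.exp (-(ρ * (T - t))) * P
  set q := Real.exp (-(ρ * t)) * Q
  set B := 2 * (k + a + 2 * ρ) * (|v 0| + |u T|)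
  have hpB : |p| ≤ Real.exp (-(ρ * (T - t))) * B := by
    rw [abs_mul, Real.abs_exp]
    gcongr
  have hqB : |q| ≤ Real.exp (-(ρ * t)) * B := by
    rw [abs_mul, Real.abs_exp]
    gcongr
  have hv : 2 * ρ * |v t| ≤ |p| + |q| := by
    rw [← abs_of_pos (by positivity : 0 < 2 * ρ), ← abs_mul,
      show 2 * ρ * v t = q - p by linear_combination hqt - hpt, add_comm]
    exact norm_sub_le q p
  have hu : 2 * ρ * k * |u t| ≤ (a + ρ) * (|p| + |q|) := by
    have haρ : |a - ρ| ≤ a + ρ := abs_le.2 ⟨by linarith, by linarith⟩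
    calc 2 * ρ * k * |u t| = |(a + ρ) * p - (a - ρ) * q| := by
          rw [← abs_of_pos (by positivity : 0 < 2 * ρ * k), ← abs_mul]
          congr 1
          linear_combination (a + ρ) * hpt - (a - ρ) * hqt
      _ ≤ |(a + ρ) * p| + |(a - ρ) * q| := norm_sub_le ((a + ρ) * p) ((a - ρ) * q)
      _ = (a + ρ) * |p| + |a - ρ| * |q| := by
          rw [abs_mul, abs_mul (a - ρ), abs_of_pos (by positivity : 0 < a + ρ)]
      _ ≤ (a + ρ) * |p| + (a + ρ) * |q| := by gcongr
      _ = (a + ρ) * (|p| + |q|) := by ring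
  calc |u t| + |v t| ≤ (k + a + ρ) / (2 * ρ * k) * (|p| + |q|) := by
        rw [div_mul_eq_mul_div, le_div_iff₀ (by positivity)]
        nlinarith [mul_le_mul_of_nonneg_left hv hk.le]
    _ ≤ (k + a + ρ) / (2 * ρ * k) *
        (Real.exp (-(ρ * (T - t))) * B + Real.exp (-(ρ * t)) * B) := by gcongr
    _ = _ := by ring
end

section
/- Let β > 0, C₀ ≥ 0, and a* > 0 satisfy 2·C₀·a*² ≤ β. Let T > 0, let a : ℝ → ℝ be differentiable on [0, T] with |a(t)| ≤ a* for all t ∈ [0, T], and suppose that for every t ∈ [0, T] one has a'(t) = −β·a(t)³ + r(t) for some function r with |r(t)| ≤ C₀·|a(t)|⁵. Then the midpoint amplitude satisfies |a(T/2)| ≤ √(2/(β·T)); in particular |a(T/2)| ≤ (√(2/β))·T^{−1/2}. -/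
/-- Comparison for the Riccati inequality `y' ≤ -β y²`: a nonnegative solution on `[0, s]`
satisfies `y s ≤ 1 / (β s)`, stated without division. -/
theorem mul_le_one_of_hasDerivAt_le_neg_mul_sq {β s : ℝ} (hβ : 0 ≤ β) (hs : 0 ≤ s) {y y' : ℝ → ℝ}
    (hy : ∀ t ∈ Set.Icc 0 s, 0 ≤ y t) (hd : ∀ t ∈ Set.Icc 0 s, HasDerivAt y (y' t) t)
    (hle : ∀ t ∈ Set.Icc 0 s, y' t ≤ -β * y t ^ 2) : β * s * y s ≤ 1 := by
  have h0 : (0 : ℝ) ∈ Set.Icc 0 s := ⟨le_rfl, hs⟩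
  have hs' : s ∈ Set.Icc 0 s := ⟨hs, le_rfl⟩
  have hanti : AntitoneOn y (Set.Icc 0 s) := by
    refine antitoneOn_of_deriv_nonpos (convex_Icc 0 s)
      (fun t ht => (hd t ht).continuousAt.continuousWithinAt)
      (fun t ht => (hd t (interior_subset ht)).differentiableAt.differentiableWithinAt)
      fun t ht => ?_
    rw [(hd t (interior_subset ht)).deriv]
    nlinarith [hle t (interior_subset ht), mul_nonneg hβ (sq_nonneg (y t))]
  rcases (hy s hs').eq_or_lt with hzero | hpos
  · simp [← hzero]
  have hypos : ∀ t ∈ Set.Icc 0 s, 0 < y t := fun t ht => hpos.trans_le (hanti ht hs' ht.2)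
  have hg : ∀ t ∈ Set.Icc 0 s,
      HasDerivAt (fun t => (y t)⁻¹ - β * t) (-y' t / y t ^ 2 - β * 1) t := fun t ht =>
    ((hd t ht).fun_inv (hypos t ht).ne').sub ((hasDerivAt_id t).const_mul β)
  have hmono : MonotoneOn (fun t => (y t)⁻¹ - β * t) (Set.Icc 0 s) := by
    refine monotoneOn_of_deriv_nonneg (convex_Icc 0 s)
      (fun t ht => (hg t ht).continuousAt.continuousWithinAt)
      (fun t ht => (hg t (interior_subset ht)).differentiableAt.differentiableWithinAt)
      fun t ht => ?_
    rw [(hg t (interior_subset ht)).deriv, sub_nonneg,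
      le_div_iff₀ (pow_pos (hypos t (interior_subset ht)) 2)]
    linarith [hle t (interior_subset ht)]
  have hend : (y 0)⁻¹ - β * 0 ≤ (y s)⁻¹ - β * s := hmono h0 hs' hs
  have hinv : β * s ≤ (y s)⁻¹ := by linarith [inv_pos.mpr (hypos 0 h0)]
  calc β * s * y s ≤ (y s)⁻¹ * y s := by gcongr
    _ = 1 := inv_mul_cancel₀ hpos.ne'

theorem cubic_midpoint_estimate (β C₀ astar : ℝ) (hβ : 0 < β) (hC₀ : 0 ≤ C₀)
    (hastar : 0 < astar) (hsmall : 2 * C₀ * astar ^ 2 ≤ β)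
    (T : ℝ) (hT : 0 < T) (a r : ℝ → ℝ)
    (hbound : ∀ t ∈ Set.Icc (0 : ℝ) T, |a t| ≤ astar)
    (hode : ∀ t ∈ Set.Icc (0 : ℝ) T, HasDerivAt a (-β * a t ^ 3 + r t) t)
    (hr : ∀ t ∈ Set.Icc (0 : ℝ) T, |r t| ≤ C₀ * |a t| ^ 5) :
    |a (T / 2)| ≤ Real.sqrt (2 / (β * T)) ∧
      |a (T / 2)| ≤ Real.sqrt (2 / β) * T ^ (-(1 / 2) : ℝ) := by
  have hsub : Set.Icc 0 (T / 2) ⊆ Set.Icc 0 T := Set.Icc_subset_Icc_right (by linarith)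
  have hmid : β * (T / 2) * a (T / 2) ^ 2 ≤ 1 := by
    refine mul_le_one_of_hasDerivAt_le_neg_mul_sq (y := fun t => a t ^ 2) hβ.le (by linarith)
      (fun t _ => sq_nonneg (a t)) (fun t ht => (hode t (hsub ht)).fun_pow 2) fun t ht => ?_
    have hprod : a t * r t ≤ C₀ * a t ^ 2 * a t ^ 4 :=
      calc a t * r t ≤ |a t| * |r t| := (le_abs_self _).trans_eq (abs_mul _ _)
        _ ≤ |a t| * (C₀ * |a t| ^ 5) := by gcongr; exact hr t (hsub ht)
        _ = C₀ * |a t| ^ 2 * (|a t| ^ 2) ^ 2 := by ring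
        _ = C₀ * a t ^ 2 * a t ^ 4 := by rw [sq_abs]; ring
    have hsq : a t ^ 2 ≤ astar ^ 2 := sq_le_sq.mpr ((hbound t (hsub ht)).trans (le_abs_self _))
    have hcoef : 2 * C₀ * a t ^ 2 ≤ β :=
      (mul_le_mul_of_nonneg_left hsq (by positivity)).trans hsmall
    have hquart : 2 * C₀ * a t ^ 2 * a t ^ 4 ≤ β * a t ^ 4 := by gcongr
    norm_num
    linarith
  have hsqrt : |a (T / 2)| ≤ Real.sqrt (2 / (β * T)) := by
    refine Real.abs_le_sqrt ?_
    rw [le_div_iff₀ (by positivity)]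
    linarith
  refine ⟨hsqrt, hsqrt.trans_eq ?_⟩
  rw [Real.rpow_neg hT.le, ← Real.sqrt_eq_rpow, ← div_div, Real.sqrt_div (by positivity),
    div_eq_mul_inv]
end

section
/- Let α > 0, β > 0, γ_c ∈ ℝ, and C ≥ 0. Let R : ℝ × ℝ → ℝ be such that for each γ the map A ↦ R(A, γ) is continuous, and suppose |R(A, γ)| ≤ C·(|γ − γ_c|²·|A| + |γ − γ_c|·|A|³ + |A|⁵) for all (A, γ) in a neighborhood of (0, γ_c). Define Ψ(A, γ) = α(γ − γ_c)·A − β·A³ + R(A, γ). Then there exists δ₀ > 0 such that for every γ with γ_c < γ < γ_c + δ₀, there exists A ∈ ℝ with (1/2)·√(α/β)·√(γ − γ_c) ≤ A ≤ 2·√(α/β)·√(γ − γ_c) and Ψ(A, γ) = 0. -/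
theorem bifurcation_branch_exists (α β γc C : ℝ) (hα : 0 < α) (hβ : 0 < β) (hC : 0 ≤ C)
    (R : ℝ → ℝ → ℝ)
    (hRcont : ∀ γ : ℝ, Continuous (fun A => R A γ))
    (η : ℝ) (hη : 0 < η)
    (hR : ∀ A γ : ℝ, |A| < η → |γ - γc| < η →
      |R A γ| ≤ C * (|γ - γc| ^ 2 * |A| + |γ - γc| * |A| ^ 3 + |A| ^ 5))
    (Ψ : ℝ → ℝ → ℝ)
    (hΨ : ∀ A γ : ℝ, Ψ A γ = α * (γ - γc) * A - β * A ^ 3 + R A γ) :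
    ∃ δ₀ : ℝ, 0 < δ₀ ∧ ∀ γ : ℝ, γc < γ → γ < γc + δ₀ →
      ∃ A : ℝ,
        (1 / 2) * Real.sqrt (α / β) * Real.sqrt (γ - γc) ≤ A ∧
        A ≤ 2 * Real.sqrt (α / β) * Real.sqrt (γ - γc) ∧
        Ψ A γ = 0 := by
  set s := Real.sqrt (α / β) with hs
  have hs0 : 0 < s := Real.sqrt_pos.2 (div_pos hα hβ)
  have hαs : α = β * s ^ 2 := by
    rw [hs, Real.sq_sqrt (div_pos hα hβ).le]
    field_simp
  set M := C * (1 + 4 * s ^ 2 + 16 * s ^ 4) + 1 with hM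
  have hM0 : 0 < M := by positivity
  refine ⟨min η (min ((η / (2 * s)) ^ 2) (3 / 4 * α / M)), by positivity, ?_⟩
  intro γ hγ hγδ
  have hε : γ - γc < min η (min ((η / (2 * s)) ^ 2) (3 / 4 * α / M)) := by linarith
  obtain ⟨hε₁, hε'⟩ := lt_min_iff.1 hε
  obtain ⟨hε₂, hε₃⟩ := lt_min_iff.1 hε'
  have hε0 : 0 < γ - γc := sub_pos.2 hγ
  set t := Real.sqrt (γ - γc) with ht
  have ht0 : 0 < t := Real.sqrt_pos.2 hε0
  have htε : γ - γc = t ^ 2 := (Real.sq_sqrt hε0.le).symm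
  have hst : 2 * s * t < η := by
    have h : t < η / (2 * s) := by
      rw [htε] at hε₂
      exact lt_of_pow_lt_pow_left₀ 2 (by positivity) hε₂
    rw [lt_div_iff₀ (by positivity)] at h
    linarith
  have hMt : t ^ 2 * M ≤ 3 / 4 * α := by
    rw [htε, lt_div_iff₀ hM0] at hε₃
    exact hε₃.le
  -- At amplitudes comparable to `s * t` the remainder is dominated by the cubic normal form.
  have key : ∀ k : ℝ, 0 < k → k ≤ 2 →
      |R (k * s * t) γ| ≤ k * s * t * t ^ 2 * (3 / 4 * α) := by
    intro k hk hk2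
    have hA : 0 < k * s * t := by positivity
    have hAη : |k * s * t| < η := by
      rw [abs_of_pos hA]
      exact lt_of_le_of_lt (by gcongr) hst
    have h := hR (k * s * t) γ hAη (by rwa [abs_of_pos hε0])
    rw [abs_of_pos hA, abs_of_pos hε0, htε] at h
    have hbound : C * (1 + k ^ 2 * s ^ 2 + k ^ 4 * s ^ 4) ≤ M := by
      have h2 : k ^ 2 ≤ 4 := by nlinarith
      have h4 : k ^ 4 ≤ 16 := by nlinarith [sq_nonneg k]
      have : C * (1 + k ^ 2 * s ^ 2 + k ^ 4 * s ^ 4) ≤ C * (1 + 4 * s ^ 2 + 16 * s ^ 4) := by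
        gcongr
      linarith
    calc |R (k * s * t) γ|
        ≤ C * ((t ^ 2) ^ 2 * (k * s * t) + t ^ 2 * (k * s * t) ^ 3 + (k * s * t) ^ 5) := h
      _ = k * s * t * t ^ 2 * (t ^ 2 * (C * (1 + k ^ 2 * s ^ 2 + k ^ 4 * s ^ 4))) := by ring
      _ ≤ k * s * t * t ^ 2 * (t ^ 2 * M) := by gcongr
      _ ≤ k * s * t * t ^ 2 * (3 / 4 * α) := by gcongr
  have hcont : Continuous fun A => Ψ A γ := by
    simp only [hΨ]
    have := hRcont γ
    fun_prop
  have hleft : 0 ≤ Ψ (1 / 2 * s * t) γ := by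
    have h := (abs_le.1 (key (1 / 2) (by norm_num) (by norm_num))).1
    rw [hΨ, htε]
    rw [hαs] at h ⊢
    linarith
  have hright : Ψ (2 * s * t) γ ≤ 0 := by
    have h := (abs_le.1 (key 2 (by norm_num) le_rfl)).2
    have hpos : 0 < β * s ^ 3 * t ^ 3 := by positivity
    rw [hΨ, htε]
    rw [hαs] at h ⊢
    linarith
  have hle : 1 / 2 * s * t ≤ 2 * s * t := by gcongr; norm_num
  obtain ⟨A, hA, hA0⟩ := intermediate_value_Icc' hle hcont.continuousOn ⟨hright, hleft⟩
  exact ⟨A, hA.1, hA.2, hA0⟩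
end

section
/- Let α > 0, β > 0, γ_c ∈ ℝ, and C ≥ 0, and let R : ℝ × ℝ → ℝ satisfy |R(A, γ)| ≤ C·(|γ − γ_c|²·|A| + |γ − γ_c|·|A|³ + |A|⁵) for all (A, γ) in a neighborhood of (0, γ_c). Define Ψ(A, γ) = α(γ − γ_c)·A − β·A³ + R(A, γ). Then there exist ε > 0, δ₀ > 0, and C' > 0 such that for every γ with γ_c < γ < γ_c + δ₀ and every A with 0 < A ≤ ε and Ψ(A, γ) = 0, one has |A² − (α/β)(γ − γ_c)| ≤ C'·(γ − γ_c)² and |A − √(α/β)·√(γ − γ_c)| ≤ C'·(γ − γ_c). -/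
/-- If `α * t - β * x` is quadratically small in `(t, x)`, then near the origin `x` is bounded by a
multiple of `t`. -/
theorem le_mul_of_abs_sub_le_quadratic {α β C t x : ℝ} (hβ : 0 < β) (hC : 0 ≤ C)
    (ht : 0 ≤ t) (ht1 : t ≤ 1) (hx : 0 ≤ x) (hCt : C * t ≤ β / 4) (hCx : C * x ≤ β / 4)
    (h : |α * t - β * x| ≤ C * (t ^ 2 + t * x + x ^ 2)) :
    x ≤ 2 * (α + C) / β * t := by
  have h₁ : C * t * x ≤ β / 4 * x := mul_le_mul_of_nonneg_right hCt hx
  have h₂ : C * x * x ≤ β / 4 * x := mul_le_mul_of_nonneg_right hCx hx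
  have h₃ : C * (t * t) ≤ C * t :=
    mul_le_mul_of_nonneg_left (mul_le_of_le_one_left ht ht1) hC
  have h₄ := (abs_le.mp h).1
  rw [div_mul_eq_mul_div, le_div_iff₀ hβ]
  linarith

/-- If `α * t - β * x` is quadratically small in `(t, x)` and `x = O(t)`, then
`x = (α / β) * t + O(t ^ 2)`. -/
theorem abs_sub_div_mul_le_of_abs_sub_le_quadratic {α β C K t x : ℝ} (hβ : 0 < β) (hC : 0 ≤ C)
    (ht : 0 ≤ t) (hx : 0 ≤ x) (hxK : x ≤ K * t)
    (h : |α * t - β * x| ≤ C * (t ^ 2 + t * x + x ^ 2)) :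
    |x - α / β * t| ≤ C * (1 + K + K ^ 2) / β * t ^ 2 := by
  have h₁ : t * x ≤ t * (K * t) := mul_le_mul_of_nonneg_left hxK ht
  have h₂ : x ^ 2 ≤ (K * t) ^ 2 := pow_le_pow_left₀ hx hxK 2
  have h₃ : C * (t ^ 2 + t * x + x ^ 2) ≤ C * (t ^ 2 + t * (K * t) + (K * t) ^ 2) := by gcongr
  have h₄ : |x - α / β * t| = |α * t - β * x| / β := by
    rw [← abs_of_pos hβ, ← abs_div, abs_of_pos hβ, abs_sub_comm]
    congr 1
    field_simp
  rw [h₄, div_mul_eq_mul_div]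
  gcongr
  linarith

/-- An estimate `A ^ 2 = m * t + O(t ^ 2)` yields `A = √m * √t + O(t)`. -/
theorem abs_sub_sqrt_mul_sqrt_le {m D t A : ℝ} (hm : 0 < m) (ht : 0 < t) (ht1 : t ≤ 1)
    (hA : 0 ≤ A) (h : |A ^ 2 - m * t| ≤ D * t ^ 2) :
    |A - √m * √t| ≤ D / √m * t := by
  have hk : 0 < √m := Real.sqrt_pos.mpr hm
  have hsqrt : t ≤ √t := Real.le_sqrt_of_sq_le (by nlinarith)
  have hsum : √m * t ≤ A + √m * √t := by
    linarith [mul_le_mul_of_nonneg_left hsqrt hk.le]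
  have hfac : |A - √m * √t| * (A + √m * √t) = |A ^ 2 - m * t| := by
    have hs : 0 ≤ A + √m * √t := by positivity
    rw [show A ^ 2 - m * t = (A - √m * √t) * (A + √m * √t) by
      linear_combination √t ^ 2 * Real.sq_sqrt hm.le + m * Real.sq_sqrt ht.le,
      abs_mul, abs_of_nonneg hs]
  have hle : |A - √m * √t| * (√m * t) ≤ D * t ^ 2 :=
    (mul_le_mul_of_nonneg_left hsum (abs_nonneg _)).trans (hfac.le.trans h)
  rw [div_mul_eq_mul_div, le_div_iff₀ hk]
  exact le_of_mul_le_mul_right (by linarith) ht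

theorem bifurcation_amplitude_asymptotics (α β γc C : ℝ) (hα : 0 < α) (hβ : 0 < β)
    (hC : 0 ≤ C) (R : ℝ → ℝ → ℝ)
    (η : ℝ) (hη : 0 < η)
    (hR : ∀ A γ : ℝ, |A| < η → |γ - γc| < η →
      |R A γ| ≤ C * (|γ - γc| ^ 2 * |A| + |γ - γc| * |A| ^ 3 + |A| ^ 5))
    (Ψ : ℝ → ℝ → ℝ)
    (hΨ : ∀ A γ : ℝ, Ψ A γ = α * (γ - γc) * A - β * A ^ 3 + R A γ) :
    ∃ ε δ₀ C' : ℝ, 0 < ε ∧ 0 < δ₀ ∧ 0 < C' ∧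
      ∀ γ : ℝ, γc < γ → γ < γc + δ₀ →
        ∀ A : ℝ, 0 < A → A ≤ ε → Ψ A γ = 0 →
          |A ^ 2 - (α / β) * (γ - γc)| ≤ C' * (γ - γc) ^ 2 ∧
          |A - Real.sqrt (α / β) * Real.sqrt (γ - γc)| ≤ C' * (γ - γc) := by
  set ρ : ℝ := β / (4 * (C + 1)) with hρ
  have hρ_pos : 0 < ρ := by positivity
  have hCρ : C * ρ ≤ β / 4 := by
    rw [hρ, mul_div_assoc', div_le_div_iff₀ (by positivity) (by norm_num)]
    nlinarith
  set K : ℝ := 2 * (α + C) / β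
  have hK : 0 < K := by positivity
  set D : ℝ := C * (1 + K + K ^ 2) / β
  have hD : 0 ≤ D := by positivity
  have hm : 0 < α / β := by positivity
  have hD' : 0 ≤ D / √(α / β) := by positivity
  refine ⟨min (η / 2) (min 1 ρ), min η (min 1 ρ), D + D / √(α / β) + 1,
    by positivity, by positivity, by positivity, fun γ hγ hγδ A hA hAε hzero => ?_⟩
  obtain ⟨t, rfl⟩ : ∃ t, γ = γc + t := ⟨γ - γc, by ring⟩
  simp only [le_min_iff] at hAε
  obtain ⟨hAη, hA1, hAρ⟩ := hAε
  have ht : 0 < t := by linarith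
  have htδ : t < min η (min 1 ρ) := by linarith
  simp only [lt_min_iff] at htδ
  obtain ⟨htη, ht1, htρ⟩ := htδ
  have hbound := hR A (γc + t) (by rw [abs_of_pos hA]; linarith)
    (by rwa [add_sub_cancel_left, abs_of_pos ht])
  rw [hΨ] at hzero
  rw [add_sub_cancel_left] at hzero hbound ⊢
  rw [abs_of_pos ht, abs_of_pos hA] at hbound
  have hred : |α * t - β * A ^ 2| ≤ C * (t ^ 2 + t * A ^ 2 + (A ^ 2) ^ 2) := by
    refine le_of_mul_le_mul_right ?_ hA
    have hR_eq : R A (γc + t) = -((α * t - β * A ^ 2) * A) := by linear_combination hzero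
    rw [hR_eq, abs_neg, abs_mul, abs_of_pos hA] at hbound
    linarith
  have hCt : C * t ≤ β / 4 := (mul_le_mul_of_nonneg_left htρ.le hC).trans hCρ
  have hCx : C * A ^ 2 ≤ β / 4 :=
    (mul_le_mul_of_nonneg_left (by nlinarith : A ^ 2 ≤ ρ) hC).trans hCρ
  have hAK : A ^ 2 ≤ K * t :=
    le_mul_of_abs_sub_le_quadratic hβ hC ht.le ht1.le (sq_nonneg A) hCt hCx hred
  have hsq : |A ^ 2 - α / β * t| ≤ D * t ^ 2 :=
    abs_sub_div_mul_le_of_abs_sub_le_quadratic hβ hC ht.le (sq_nonneg A) hAK hred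
  refine ⟨hsq.trans ?_, (abs_sub_sqrt_mul_sqrt_le hm ht ht1.le hA.le hsq).trans ?_⟩
  · gcongr
    linarith
  · gcongr
    linarith
end
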